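/- Let w ≥ 1, 1 ≤ p ≤ w, n ≥ 1, let a(t) = Σ_{k=p−w}^p a_k t^k be a Laurent polynomial with a_p ≠ 0, let x ∈ ℂ be an eigenvalue of T_n(a), and suppose the zeros z_1,…,z_w of a − x (i.e. a(t) − x = a_p t^{p−w} ∏_{j=1}^w (t − z_j)) are pairwise distinct. Then there exist complex numbers C_1,…,C_w, independent of r, such that the vector v with components v_r = s_{((n−1)^{p−1}, n−r)}(z_1,…,z_w) satisfies v_r = Σ_{j=1}^w C_j · z_j^{n−r+w−p} for every r ∈ {1,…,n}; that is, v is a linear combination of geometric progressions with ratios 1/z_1,…,1/z_w. -/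

import Mathlib

open scoped BigOperators

/-- The `r`-th elementary symmetric polynomial in `w` variables, evaluated at `z`,
extended by `0` to negative integer indices (and automatically `0` for `r > w`). -/
noncomputable def eInt (w : ℕ) (z : Fin w → ℂ) (r : ℤ) : ℂ :=
  if 0 ≤ r then
    ∑ s ∈ Finset.powersetCard r.toNat (Finset.univ : Finset (Fin w)), ∏ i ∈ s, z i
  else 0

/-- The `r`-th complete homogeneous symmetric polynomial in `w` variables, evaluated at `z`,
extended by `0` to negative integer indices. -/
noncomputable def hInt (w : ℕ) (z : Fin w → ℂ) (r : ℤ) : ℂ :=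
  if 0 ≤ r then ∑ m : Sym (Fin w) r.toNat, (m.1.map z).prod else 0

/-- Skew Schur polynomial via the Jacobi–Trudi determinant
`s_{λ/μ} = det [h_{λ_j - μ_k - j + k}]_{j,k=1}^{ℓ}`,
where the parts are given as `1`-based integer sequences `lam`, `mu`. -/
noncomputable def skewSchur (w : ℕ) (z : Fin w → ℂ) (ℓ : ℕ) (lam mu : ℕ → ℤ) : ℂ :=
  Matrix.det (Matrix.of fun j k : Fin ℓ =>
    hInt w z (lam (j.1 + 1) - mu (k.1 + 1) - ((j.1 : ℤ) + 1) + ((k.1 : ℤ) + 1)))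

/-- Schur polynomial `s_λ`. -/
noncomputable def schur (w : ℕ) (z : Fin w → ℂ) (ℓ : ℕ) (lam : ℕ → ℤ) : ℂ :=
  skewSchur w z ℓ lam (fun _ => 0)

/-- Coefficients of the Laurent polynomial `a(t) = a_p t^(p-w) ∏_{j=1}^w (t - z_j)`,
namely `a_k = (-1)^(p-k) * a_p * e_{p-k}(z_1,…,z_w)`. -/
noncomputable def aCoeff (w p : ℕ) (ap : ℂ) (z : Fin w → ℂ) (k : ℤ) : ℂ :=
  (-1 : ℂ) ^ ((p : ℤ) - k) * ap * eInt w z ((p : ℤ) - k)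

/-- The `n × n` Toeplitz matrix `[a_{j-k}]_{j,k=1}^n` with coefficient sequence `a`. -/
noncomputable def toeplitz (n : ℕ) (a : ℤ → ℂ) : Matrix (Fin n) (Fin n) ℂ :=
  Matrix.of fun j k => a ((j.1 : ℤ) - (k.1 : ℤ))

/-- Splitting off the variable `a` in a complete homogeneous symmetric sum:
`h_{n+1}(a, f) = a * h_n(a, f) + h_{n+1}(f)`. -/
theorem sum_sym_option_succ {α R : Type*} [Fintype α] [DecidableEq α] [CommSemiring R]
    (f : Option α → R) (n : ℕ) :
    ∑ m : Sym (Option α) (n + 1), (m.1.map f).prod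
      = f none * ∑ m : Sym (Option α) n, (m.1.map f).prod
        + ∑ m : Sym α (n + 1), (m.1.map (fun i => f (some i))).prod := by
  rw [← (symOptionSuccEquiv (α := α) (n := n)).symm.sum_comp, Fintype.sum_sum_type,
    Finset.mul_sum]
  congr 1
  · refine Finset.sum_congr rfl fun m _ => ?_
    change ((none ::ₘ m.1).map f).prod = _
    simp
  · refine Finset.sum_congr rfl fun m _ => ?_
    change ((m.1.map some).map f).prod = _
    simp [Multiset.map_map]

/-- A complete homogeneous symmetric sum is invariant under reindexing of the variables. -/
theorem sum_sym_equiv {α β R : Type*} [Fintype α] [DecidableEq α] [Fintype β] [DecidableEq β]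
    [CommSemiring R] (e : α ≃ β) (f : β → R) (n : ℕ) :
    ∑ m : Sym β n, (m.1.map f).prod = ∑ m : Sym α n, (m.1.map (fun i => f (e i))).prod := by
  rw [← (Sym.equivCongr (n := n) e).sum_comp]
  refine Finset.sum_congr rfl fun m _ => ?_
  change ((m.1.map e).map f).prod = _
  simp [Multiset.map_map]

theorem hInt_of_neg {w : ℕ} (z : Fin w → ℂ) {r : ℤ} (hr : r < 0) : hInt w z r = 0 :=
  if_neg (by omega)

theorem hInt_natCast {w : ℕ} (z : Fin w → ℂ) (n : ℕ) :
    hInt w z n = ∑ m : Sym (Fin w) n, (m.1.map z).prod := by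
  rw [hInt, if_pos (by omega)]
  rfl

theorem hInt_zero {w : ℕ} (z : Fin w → ℂ) : hInt w z 0 = 1 := by
  rw [← Nat.cast_zero, hInt_natCast]
  simp [Sym.eq_nil_of_card_zero]

/-- The recurrence `h_r(z_0, …, z_w) = z_0 h_{r-1}(z_0, …, z_w) + h_r(z_1, …, z_w)`. -/
theorem hInt_succ {w : ℕ} (z : Fin (w + 1) → ℂ) (r : ℤ) :
    hInt (w + 1) z r = z 0 * hInt (w + 1) z (r - 1) + hInt w (fun i => z i.succ) r := by
  rcases lt_trichotomy r 0 with hr | rfl | hr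
  · simp [hInt_of_neg, hr, show r - 1 < 0 by omega]
  · simp [hInt_of_neg, hInt_zero]
  · obtain ⟨n, rfl⟩ : ∃ n : ℕ, r = ((n + 1 : ℕ) : ℤ) := ⟨(r - 1).toNat, by omega⟩
    rw [show ((n + 1 : ℕ) : ℤ) - 1 = (n : ℕ) by push_cast; ring, hInt_natCast, hInt_natCast,
      hInt_natCast, sum_sym_equiv (finSuccEquiv w).symm z (n + 1),
      sum_sym_equiv (finSuccEquiv w).symm z n, sum_sym_option_succ]
    simp

/-- For distinct `z_1, …, z_w`, the sequence `h_{1-w}, h_{2-w}, …` is a linear combination of the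
geometric progressions with ratios `z_1, …, z_w`. -/
theorem exists_hInt_eq_sum_pow {w : ℕ} (z : Fin w → ℂ) (hz : Function.Injective z) :
    ∃ D : Fin w → ℂ, ∀ N : ℕ, hInt w z ((N : ℤ) - w + 1) = ∑ j, D j * z j ^ N := by
  induction w with
  | zero =>
    refine ⟨0, fun N => ?_⟩
    rw [show (N : ℤ) - (0 : ℕ) + 1 = (N + 1 : ℕ) by push_cast; ring, hInt_natCast]
    simp
  | succ w ih =>
    obtain ⟨D, hD⟩ := ih (fun i => z i.succ) (hz.comp (Fin.succ_injective w))
    have hne : ∀ i : Fin w, z i.succ - z 0 ≠ 0 := fun i =>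
      sub_ne_zero.mpr fun h => Fin.succ_ne_zero i (hz h)
    refine ⟨Fin.cons
      (hInt (w + 1) z (-w) - ∑ i, D i / (z i.succ - z 0))
      (fun i => D i / (z i.succ - z 0)), fun N => ?_⟩
    rw [Fin.sum_univ_succ]
    simp only [Fin.cons_zero, Fin.cons_succ]
    induction N with
    | zero => simp
    | succ N ihN =>
      rw [hInt_succ,
        show ((N + 1 : ℕ) : ℤ) - (w + 1 : ℕ) + 1 - 1 = (N : ℤ) - (w + 1 : ℕ) + 1 by
          push_cast; ring,
        ihN,
        show ((N + 1 : ℕ) : ℤ) - (w + 1 : ℕ) + 1 = (N : ℤ) - w + 1 by push_cast; ring,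
        hD, mul_add, add_assoc, Finset.mul_sum, ← Finset.sum_add_distrib]
      congr 1
      · ring
      · refine Finset.sum_congr rfl fun i _ => ?_
        have := hne i
        field_simp
        ring

/-- Theorem 3, formula (eq:eigvec_Trench): if `1 ≤ p ≤ w`, `x` is an eigenvalue of `T_n(a)`,
and the zeros `z_1,…,z_w` of `a - x` are pairwise distinct, then there exist
`C_1,…,C_w ∈ ℂ` (independent of `r`) such that
`v_r = s_{((n-1)^{p-1}, n-r)}(z) = Σ_{j=1}^w C_j z_j^{n-r+w-p}` for all `1 ≤ r ≤ n`. -/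
theorem toeplitz_eigenvector_trench
    (w p n : ℕ) (hw : 1 ≤ w) (hp : 1 ≤ p) (hpw : p ≤ w) (hn : 1 ≤ n)
    (a : ℤ → ℂ)
    (hband : ∀ k : ℤ, ((p : ℤ) < k ∨ k < (p : ℤ) - (w : ℤ)) → a k = 0)
    (hap : a (p : ℤ) ≠ 0)
    (x : ℂ)
    (hx : Matrix.det (toeplitz n a - x • (1 : Matrix (Fin n) (Fin n) ℂ)) = 0)
    (z : Fin w → ℂ)
    (hz : ∀ k : ℤ, a k - (if k = 0 then x else 0) = aCoeff w p (a (p : ℤ)) z k)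
    (hzdist : Function.Injective z) :
    ∃ C : Fin w → ℂ, ∀ r : ℕ, 1 ≤ r → r ≤ n →
      schur w z p (fun j => if j ≤ p - 1 then (n : ℤ) - 1 else (n : ℤ) - (r : ℤ))
        = ∑ j : Fin w, C j * z j ^ (n - r + w - p) := by
  obtain ⟨q, rfl⟩ : ∃ q, p = q + 1 := ⟨p - 1, by omega⟩
  obtain ⟨D, hD⟩ := exists_hInt_eq_sum_pow z hzdist
  let M : Matrix (Fin (q + 1)) (Fin (q + 1)) ℂ :=
    Matrix.of fun j k => hInt w z ((n : ℤ) - 1 - ((j.1 : ℤ) + 1) + ((k.1 : ℤ) + 1))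
  refine ⟨fun i => (M.updateRow (Fin.last q) fun k => D i * z i ^ k.1).det, fun r hr hrn => ?_⟩
  have hrow : schur w z (q + 1)
      (fun j => if j ≤ q + 1 - 1 then (n : ℤ) - 1 else (n : ℤ) - (r : ℤ))
      = (M.updateRow (Fin.last q)
          (∑ i, z i ^ (n - r + w - (q + 1)) • fun k : Fin (q + 1) => D i * z i ^ k.1)).det := by
    unfold schur skewSchur
    congr 1
    ext j k
    rcases Fin.eq_castSucc_or_eq_last j with ⟨j, rfl⟩ | rfl
    · rw [Matrix.updateRow_ne (Fin.castSucc_lt_last j).ne]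
      simp [M]
    · rw [Matrix.updateRow_self, Matrix.of_apply, Fin.val_last]
      beta_reduce
      rw [if_neg (by omega),
        show (n : ℤ) - r - 0 - ((q : ℤ) + 1) + ((k.1 : ℤ) + 1)
          = ((n - r + w - (q + 1) + k.1 : ℕ) : ℤ) - w + 1 by omega, hD]
      simp only [Finset.sum_apply, Pi.smul_apply, smul_eq_mul, pow_add]
      exact Finset.sum_congr rfl fun i _ => by ring
  rw [hrow, ← Matrix.cramer_transpose_apply, map_sum, Finset.sum_apply]
  refine Finset.sum_congr rfl fun i _ => ?_
  rw [map_smul, Pi.smul_apply, Matrix.cramer_transpose_apply, smul_eq_mul, mul_comm]
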